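/- Let d ≥ 1 and consider the formal Hamiltonian H(x) = Σ_{i∈ℤ^d} ψ_i(x_i) + (1/2) Σ_{i,j∈ℤ^d} M_{ij} x_i x_j with smooth single-site potentials ψ_i = ψ_i^c + ψ_i^b satisfying (ψ_i^c)'' ≥ 0 and |ψ_i^b| + |(ψ_i^b)'| ≤ C_0, M symmetric with sup_i Σ_j |M_{ij}| < ∞ and strictly diagonally dominant: Σ_{j≠i} |M_{ij}| + δ ≤ M_{ii} for some δ > 0. Then there is a constant C < ∞, depending only on δ, C_0 and sup_i Σ_j |M_{ij}|, such that for every finite Λ ⊂ ℤ^d, every tempered boundary condition, and every i ∈ Λ, the finite-volume Gibbs measure μ_Λ satisfies Var_{μ_Λ}(x_i) ≤ C. -/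

import Mathlib

open MeasureTheory Real

noncomputable section

namespace GibbsLSI

variable {ι : Type*} [DecidableEq ι]

/-- Covariance of two observables under a measure. -/
def cov {X : Type*} [MeasurableSpace X] (μ : Measure X) (f g : X → ℝ) : ℝ :=
  ∫ x, f x * g x ∂μ - (∫ x, f x ∂μ) * ∫ x, g x ∂μ

/-- Variance of an observable under a measure. -/
def varOf {X : Type*} [MeasurableSpace X] (μ : Measure X) (f : X → ℝ) : ℝ :=
  ∫ x, (f x - ∫ y, f y ∂μ) ^ 2 ∂μ

/-- Partial derivative of `f` in coordinate `i`. -/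
def pderiv {κ : Type*} [DecidableEq κ] (f : (κ → ℝ) → ℝ) (i : κ) (x : κ → ℝ) : ℝ :=
  deriv (fun t => f (Function.update x i t)) (x i)

/-- Squared norm of the gradient of `f`. -/
def gradSq {κ : Type*} [DecidableEq κ] [Fintype κ] (f : (κ → ℝ) → ℝ) (x : κ → ℝ) : ℝ :=
  ∑ i, (pderiv f i x) ^ 2

/-- The logarithmic Sobolev inequality with constant `ρ` for a measure on `κ → ℝ`. -/
def satisfiesLSI {κ : Type*} [DecidableEq κ] [Fintype κ] (μ : Measure (κ → ℝ)) (ρ : ℝ) : Prop :=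
  ∀ f : (κ → ℝ) → ℝ, ContDiff ℝ (⊤ : ℕ∞) f → (∀ x, 0 ≤ f x) →
    ∫ x, f x * log (f x) ∂μ - (∫ x, f x ∂μ) * log (∫ x, f x ∂μ) ≤
      (1 / (2 * ρ)) * ∫ x, gradSq f x / f x ∂μ

/-- The Poincaré inequality with constant `ρ` for a measure on `κ → ℝ`. -/
def satisfiesPI {κ : Type*} [DecidableEq κ] [Fintype κ] (μ : Measure (κ → ℝ)) (ρ : ℝ) : Prop :=
  ∀ f : (κ → ℝ) → ℝ, ContDiff ℝ (⊤ : ℕ∞) f → varOf μ f ≤ (1 / ρ) * ∫ x, gradSq f x ∂μ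

/-- The logarithmic Sobolev inequality for a measure on `ℝ`. -/
def satisfiesLSI1 (μ : Measure ℝ) (ρ : ℝ) : Prop :=
  ∀ f : ℝ → ℝ, ContDiff ℝ (⊤ : ℕ∞) f → (∀ x, 0 ≤ f x) →
    ∫ x, f x * log (f x) ∂μ - (∫ x, f x ∂μ) * log (∫ x, f x ∂μ) ≤
      (1 / (2 * ρ)) * ∫ x, (deriv f x) ^ 2 / f x ∂μ

/-- The Poincaré inequality for a measure on `ℝ`. -/
def satisfiesPI1 (μ : Measure ℝ) (ρ : ℝ) : Prop :=
  ∀ f : ℝ → ℝ, ContDiff ℝ (⊤ : ℕ∞) f → varOf μ f ≤ (1 / ρ) * ∫ x, (deriv f x) ^ 2 ∂μ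

/-- Extend a configuration on `Λ` by the boundary values `ω` outside of `Λ`. -/
def patch (Λ : Finset ι) (x : ↥Λ → ℝ) (ω : ι → ℝ) : ι → ℝ :=
  fun i => if h : i ∈ Λ then x ⟨i, h⟩ else ω i

/-- The part of the formal Hamiltonian involving sites of `Λ`, evaluated at a full
configuration `y`. -/
def ham (ψ : ι → ℝ → ℝ) (M : ι → ι → ℝ) (Λ : Finset ι) (y : ι → ℝ) : ℝ :=
  ∑ i ∈ Λ, ψ i (y i) + (1 / 2) * ∑ i ∈ Λ, ∑ j ∈ Λ, M i j * y i * y j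
    + ∑ i ∈ Λ, y i * ∑' j : {j : ι // j ∉ Λ}, M i j.1 * y j.1

/-- Tempered boundary values. -/
def tempered (M : ι → ι → ℝ) (Λ : Finset ι) (ω : ι → ℝ) : Prop :=
  ∀ i ∈ Λ, Summable fun j : {j : ι // j ∉ Λ} => |M i j.1| * |ω j.1|

/-- The finite-volume Gibbs measure on `ℝ^Λ` with boundary values `ω`. -/
def gibbs (ψ : ι → ℝ → ℝ) (M : ι → ι → ℝ) (Λ : Finset ι) (ω : ι → ℝ) :
    Measure (↥Λ → ℝ) :=
  volume.withDensity fun x =>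
    ENNReal.ofReal (exp (-ham ψ M Λ (patch Λ x ω)) /
      ∫ z : ↥Λ → ℝ, exp (-ham ψ M Λ (patch Λ z ω)))


/-- A differentiable convex function on the line lies above its tangents. -/
lemma exists_supporting_line {f : ℝ → ℝ} (hf : ConvexOn ℝ Set.univ f)
    (hd : Differentiable ℝ f) (m : ℝ) : ∃ a, ∀ x, f m + a * (x - m) ≤ f x := by
  refine ⟨deriv f m, fun x => ?_⟩
  rcases lt_trichotomy m x with h | rfl | h
  · have := hf.deriv_le_slope (Set.mem_univ m) (Set.mem_univ x) h (hd m)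
    rw [slope_def_field, le_div_iff₀ (sub_pos.2 h)] at this
    linarith
  · simp
  · have := hf.slope_le_deriv (Set.mem_univ x) (Set.mem_univ m) h (hd m)
    rw [slope_def_field, div_le_iff₀ (sub_pos.2 h)] at this
    linarith

section FiniteVolume

variable {κ : Type*} [Fintype κ]

/-- Energy with single-site potentials `ψ`, quadratic interaction `A` and external field `b`. -/
def energy (ψ : κ → ℝ → ℝ) (A : κ → κ → ℝ) (b : κ → ℝ) (x : κ → ℝ) : ℝ :=
  ∑ k, ψ k (x k) + (1 / 2) * ∑ k, ∑ l, A k l * x k * x l + ∑ k, x k * b k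

lemma continuous_energy {ψ : κ → ℝ → ℝ} {A : κ → κ → ℝ} {b : κ → ℝ}
    (hψ : ∀ k, Continuous (ψ k)) : Continuous (energy ψ A b) := by
  unfold energy
  fun_prop

lemma energy_sub_energy_add_single [DecidableEq κ] {ψ : κ → ℝ → ℝ} {A : κ → κ → ℝ} {b : κ → ℝ}
    (hA : ∀ k l, A k l = A l k) (i : κ) (x : κ → ℝ) (t : ℝ) :
    energy ψ A b x - energy ψ A b (x + Pi.single i t) =
      ψ i (x i) - ψ i (x i + t) - t * (∑ l, A i l * x l) - A i i * t ^ 2 / 2 - t * b i := by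
  have h1 : ∑ k, ψ k ((x + Pi.single i t : κ → ℝ) k) =
      ∑ k, ψ k (x k) + (ψ i (x i + t) - ψ i (x i)) := by
    rw [← sub_eq_iff_eq_add', ← Finset.sum_sub_distrib, Finset.sum_eq_single i]
    · simp
    · intro k _ hk
      simp [hk]
    · simp
  have h2 : ∑ k, ∑ l, A k l * (x + Pi.single i t : κ → ℝ) k * (x + Pi.single i t : κ → ℝ) l =
      ∑ k, ∑ l, A k l * x k * x l + 2 * t * (∑ l, A i l * x l) + A i i * t ^ 2 := by
    have e : ∀ k l, A k l * (x + Pi.single i t : κ → ℝ) k * (x + Pi.single i t : κ → ℝ) l =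
        A k l * x k * x l + (if l = i then t * (A k i * x k) else 0)
          + (if k = i then t * (A i l * x l) else 0)
          + (if k = i then (if l = i then A i i * t ^ 2 else 0) else 0) := by
      intro k l
      by_cases hk : k = i <;> by_cases hl : l = i <;>
        simp only [hk, hl, Pi.add_apply, Pi.single_eq_same, ne_eq, not_false_eq_true,
          Pi.single_eq_of_ne, if_true, if_false] <;> ring
    simp only [e, Finset.sum_add_distrib, Finset.sum_ite_eq', Finset.mem_univ, if_true]
    have e2 : ∑ k, ∑ l, (if k = i then t * (A i l * x l) else 0) = t * ∑ l, A i l * x l := by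
      rw [Finset.sum_eq_single i]
      · simp [Finset.mul_sum]
      · intro k _ hk
        simp [hk]
      · simp
    have e3 : ∑ k, ∑ l, (if k = i then (if l = i then A i i * t ^ 2 else 0) else 0)
        = A i i * t ^ 2 := by
      rw [Finset.sum_eq_single i]
      · simp
      · intro k _ hk
        simp [hk]
      · simp
    have e4 : ∑ k, t * (A k i * x k) = t * ∑ l, A i l * x l := by
      simp only [Finset.mul_sum, fun k => hA k i]
    rw [e2, e3, e4]
    ring
  have h3 : ∑ k, (x + Pi.single i t : κ → ℝ) k * b k = ∑ k, x k * b k + t * b i := by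
    simp [add_mul, Finset.sum_add_distrib, Pi.single_apply]
  unfold energy
  rw [h1, h2, h3]
  ring

/-- Young's inequality for one row of a matrix, with the diagonal entry kept. -/
lemma row_lower_bound [DecidableEq κ] {A : κ → κ → ℝ} (i : κ) (hA : 0 ≤ A i i) (x : κ → ℝ) :
    2 * A i i * x i ^ 2 - (∑ l, |A i l| * (x i ^ 2 + x l ^ 2)) / 2 ≤
      x i * ∑ l, A i l * x l := by
  have h : ∀ l, (if l = i then 2 * A i i * x i ^ 2 else 0)
      - |A i l| * (x i ^ 2 + x l ^ 2) / 2 ≤ x i * (A i l * x l) := by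
    intro l
    by_cases hl : l = i
    · subst hl
      rw [if_pos rfl, abs_of_nonneg hA]
      nlinarith
    · rw [if_neg hl]
      nlinarith [mul_nonneg (sub_nonneg.2 (neg_abs_le (A i l))) (sq_nonneg (x i + x l)),
        mul_nonneg (sub_nonneg.2 (le_abs_self (A i l))) (sq_nonneg (x i - x l))]
  have := Finset.sum_le_sum fun l (_ : l ∈ Finset.univ) => h l
  simpa [Finset.sum_sub_distrib, Finset.mul_sum, Finset.sum_div] using this

lemma quadratic_form_lower_bound [DecidableEq κ] {A : κ → κ → ℝ} {δ : ℝ}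
    (hA : ∀ k l, A k l = A l k) (hpos : ∀ k, 0 ≤ A k k)
    (hdom : ∀ k, ∑ l, |A k l| + δ ≤ 2 * A k k) (x : κ → ℝ) :
    δ * ∑ k, x k ^ 2 ≤ ∑ k, ∑ l, A k l * x k * x l := by
  have h := Finset.sum_le_sum fun k (_ : k ∈ Finset.univ) => row_lower_bound k (hpos k) x
  have e1 : ∑ k, x k * ∑ l, A k l * x l = ∑ k, ∑ l, A k l * x k * x l := by
    simp only [Finset.mul_sum]
    exact Finset.sum_congr rfl fun k _ => Finset.sum_congr rfl fun l _ => by ring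
  have e2 : ∑ k, ∑ l, |A k l| * x l ^ 2 = ∑ k, ∑ l, |A k l| * x k ^ 2 := by
    rw [Finset.sum_comm]
    exact Finset.sum_congr rfl fun k _ => Finset.sum_congr rfl fun l _ => by rw [hA]
  have e3 : ∑ k, (∑ l, |A k l| * (x k ^ 2 + x l ^ 2)) / 2 = ∑ k, (∑ l, |A k l|) * x k ^ 2 := by
    rw [← Finset.sum_div]
    simp only [mul_add, Finset.sum_add_distrib, e2, Finset.sum_mul]
    ring
  rw [e1, Finset.sum_sub_distrib, e3, ← Finset.sum_sub_distrib] at h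
  refine le_trans ?_ h
  rw [Finset.mul_sum]
  refine Finset.sum_le_sum fun k _ => ?_
  nlinarith [hdom k, sq_nonneg (x k)]

lemma exists_energy_lower_bound [DecidableEq κ] {ψ ψc ψb : κ → ℝ → ℝ} {A : κ → κ → ℝ}
    {b : κ → ℝ} {δ C0 : ℝ} (hδ : 0 < δ) (hψ : ∀ k, ψ k = ψc k + ψb k)
    (hconv : ∀ k, ConvexOn ℝ Set.univ (ψc k)) (hdiff : ∀ k, Differentiable ℝ (ψc k))
    (hbdd : ∀ k t, |ψb k t| ≤ C0)
    (hA : ∀ k l, A k l = A l k) (hpos : ∀ k, 0 ≤ A k k)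
    (hdom : ∀ k, ∑ l, |A k l| + δ ≤ 2 * A k k) :
    ∃ K, ∀ x, δ / 4 * ∑ k, x k ^ 2 - K ≤ energy ψ A b x := by
  choose a ha using fun k => exists_supporting_line (hconv k) (hdiff k) 0
  refine ⟨∑ k, (C0 - ψc k 0 + (a k + b k) ^ 2 / δ), fun x => ?_⟩
  have hq := quadratic_form_lower_bound hA hpos hdom x
  have h : ∑ k, (-(δ / 4 * x k ^ 2) - (C0 - ψc k 0 + (a k + b k) ^ 2 / δ)) ≤
      ∑ k, (ψ k (x k) + x k * b k) := by
    refine Finset.sum_le_sum fun k _ => ?_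
    have h1 := ha k (x k)
    have h2 := neg_le_of_abs_le (hbdd k (x k))
    have h3 : 0 ≤ δ / 4 * x k ^ 2 + (a k + b k) * x k + (a k + b k) ^ 2 / δ := by
      have : δ / 4 * x k ^ 2 + (a k + b k) * x k + (a k + b k) ^ 2 / δ =
          (δ * x k / 2 + (a k + b k)) ^ 2 / δ := by
        field_simp
        ring
      rw [this]
      positivity
    rw [hψ, Pi.add_apply]
    nlinarith
  unfold energy
  simp only [Finset.sum_sub_distrib, Finset.sum_neg_distrib, ← Finset.mul_sum,
    Finset.sum_add_distrib] at h ⊢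
  linarith

/-- Functions of quadratic growth are integrable against weights with a Gaussian tail. -/
lemma integrable_exp_neg_mul_of_le {V f : (κ → ℝ) → ℝ} {δ K c : ℝ} (hδ : 0 < δ)
    (hV : Continuous V) (hK : ∀ x, δ / 4 * ∑ k, x k ^ 2 - K ≤ V x)
    (hf : Continuous f) (hc : ∀ x, |f x| ≤ c * (1 + ∑ k, x k ^ 2)) :
    Integrable fun x => exp (-V x) * f x := by
  have hg : Integrable fun x : κ → ℝ => ∏ k, exp (-(δ / 8) * x k ^ 2) :=
    Integrable.fintype_prod (f := fun _ t => exp (-(δ / 8) * t ^ 2))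
      fun _ => integrable_exp_neg_mul_sq (by positivity)
  have hc0 : 0 ≤ c := by simpa using (abs_nonneg _).trans (hc 0)
  refine (hg.const_mul (exp K * c * (1 + 8 / δ))).mono'
    (by fun_prop) (Filter.Eventually.of_forall fun x => ?_)
  set S := ∑ k, x k ^ 2
  have hS : 0 ≤ S := Finset.sum_nonneg fun k _ => sq_nonneg _
  have h1 : exp (-V x) ≤ exp K * exp (-(δ / 8) * S) * exp (-(δ / 8) * S) := by
    rw [← exp_add, ← exp_add]
    exact exp_le_exp.2 (by linarith [hK x])
  have h2 : 1 + S ≤ (1 + 8 / δ) * exp (δ / 8 * S) := by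
    have := add_one_le_exp (δ / 8 * S)
    have h3 : 1 ≤ exp (δ / 8 * S) := one_le_exp (by positivity)
    have h4 : S = 8 / δ * (δ / 8 * S) := by field_simp
    have h5 : 8 / δ * (δ / 8 * S) ≤ 8 / δ * exp (δ / 8 * S) := by
      gcongr
      linarith
    linarith
  have h6 : exp (-(δ / 8) * S) * exp (δ / 8 * S) = 1 := by
    rw [← exp_add]
    simp
  rw [← exp_sum, ← Finset.mul_sum, norm_mul, norm_eq_abs, norm_eq_abs, abs_exp]
  calc exp (-V x) * |f x|
      ≤ (exp K * exp (-(δ / 8) * S) * exp (-(δ / 8) * S)) *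
          (c * ((1 + 8 / δ) * exp (δ / 8 * S))) := by
        gcongr
        exact (hc x).trans (by gcongr)
    _ = exp K * c * (1 + 8 / δ) * exp (-(δ / 8) * S) *
          (exp (-(δ / 8) * S) * exp (δ / 8 * S)) := by ring
    _ = _ := by rw [h6, mul_one]

/-- Change of variables under the contraction by `1 - s` of the `i`-th coordinate towards `m`. -/
lemma contract_coordinate [DecidableEq κ] {g : (κ → ℝ) → ℝ} (hg : Integrable g) (i : κ)
    (m s : ℝ) (hs : s < 1) :
    Integrable (fun x : κ → ℝ => g (x + Pi.single i (-(s * (x i - m))))) ∧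
      ∫ x : κ → ℝ, g (x + Pi.single i (-(s * (x i - m)))) = (1 - s)⁻¹ * ∫ x, g x := by
  set D : κ → ℝ := Function.update (fun _ => 1) i (1 - s)
  have hdet : (Matrix.diagonal D).det = 1 - s := by
    rw [Matrix.det_diagonal, Finset.prod_update_of_mem (Finset.mem_univ i)]
    simp
  have hs' : 0 < 1 - s := sub_pos.2 hs
  have hmap : Measure.map (Matrix.toLin' (Matrix.diagonal D)) (volume : Measure (κ → ℝ)) =
      ENNReal.ofReal (1 - s)⁻¹ • volume := by
    rw [Real.map_matrix_volume_pi_eq_smul_volume_pi (by rw [hdet]; exact hs'.ne'), hdet,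
      abs_of_pos (by positivity)]
  have hT : ∀ x : κ → ℝ, x + Pi.single i (-(s * (x i - m))) =
      Matrix.toLin' (Matrix.diagonal D) x + Pi.single i (s * m) := by
    intro x
    ext k
    by_cases hk : k = i
    · subst hk
      simp [D, Matrix.mulVec_diagonal]
      ring
    · simp [D, Matrix.mulVec_diagonal, hk]
  have hg' : Integrable fun x : κ → ℝ => g (x + Pi.single i (s * m)) := hg.comp_add_right _
  have hmeas : Measurable (Matrix.toLin' (Matrix.diagonal D) : (κ → ℝ) → κ → ℝ) :=
    (LinearMap.continuous_on_pi _).measurable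
  have hgi : Integrable (fun x => g (x + Pi.single i (s * m)))
      (Measure.map (Matrix.toLin' (Matrix.diagonal D)) (volume : Measure (κ → ℝ))) := by
    rw [hmap]
    exact hg'.smul_measure ENNReal.ofReal_ne_top
  simp only [hT]
  refine ⟨hgi.comp_measurable hmeas, ?_⟩
  refine (integral_map hmeas.aemeasurable hgi.aestronglyMeasurable).symm.trans ?_
  rw [hmap, integral_smul_measure,
    integral_add_right_eq_self (μ := volume) g, ENNReal.toReal_ofReal (by positivity), smul_eq_mul]

lemma abs_coordinate_le (x : κ → ℝ) (k : κ) : |x k| ≤ 1 + ∑ l, x l ^ 2 := by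
  have := Finset.single_le_sum (fun l _ => sq_nonneg (x l)) (Finset.mem_univ k)
  nlinarith [sq_abs (x k), sq_nonneg (|x k| - 1)]

lemma abs_sq_coordinate_sub_le (x : κ → ℝ) (k : κ) (m : ℝ) :
    |(x k - m) ^ 2| ≤ (2 + 2 * m ^ 2) * (1 + ∑ l, x l ^ 2) := by
  have := Finset.single_le_sum (fun l _ => sq_nonneg (x l)) (Finset.mem_univ k)
  rw [abs_of_nonneg (sq_nonneg _)]
  nlinarith [sq_nonneg (x k + m), sq_nonneg (x k), sq_nonneg m,
    mul_nonneg (sq_nonneg m) ((sq_nonneg (x k)).trans this)]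

/-- Change of the energy under contraction of one coordinate, estimated from below. -/
lemma exists_le_energy_sub_contract [DecidableEq κ] {ψ ψc ψb : κ → ℝ → ℝ} {A : κ → κ → ℝ}
    {b : κ → ℝ} {δ C0 : ℝ} (hδ : 0 < δ) (hψ : ∀ k, ψ k = ψc k + ψb k)
    (hconv : ∀ k, ConvexOn ℝ Set.univ (ψc k)) (hdiff : ∀ k, Differentiable ℝ (ψc k))
    (hlip : ∀ k t t', |ψb k t - ψb k t'| ≤ C0 * |t - t'|)
    (hA : ∀ k l, A k l = A l k) (hpos : ∀ k, 0 ≤ A k k) (i : κ) (m : κ → ℝ) :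
    ∃ a : ℝ, ∀ s, 0 ≤ s → s ≤ 1 → ∀ x : κ → ℝ,
      s * (a * (x i - m i) - C0 ^ 2 / (2 * δ)
        + (2 * A i i - δ / 2 - s * A i i / 2) * (x i - m i) ^ 2
        - (∑ l, |A i l| * ((x i - m i) ^ 2 + (x l - m l) ^ 2)) / 2) ≤
      energy ψ A b x - energy ψ A b (x + Pi.single i (-(s * (x i - m i)))) := by
  obtain ⟨a, ha⟩ := exists_supporting_line (hconv i) (hdiff i) (m i)
  refine ⟨a + b i + ∑ l, A i l * m l, fun s hs0 hs1 x => ?_⟩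
  have hrow := row_lower_bound i (hpos i) (fun l => x l - m l)
  have hsum : ∑ l, A i l * (x l - m l) = ∑ l, A i l * x l - ∑ l, A i l * m l := by
    simp [mul_sub, Finset.sum_sub_distrib]
  simp only [hsum] at hrow
  rw [energy_sub_energy_add_single hA, hψ, Pi.add_apply, Pi.add_apply]
  generalize ∑ l, |A i l| * ((x i - m i) ^ 2 + (x l - m l) ^ 2) = R at *
  generalize ∑ l, A i l * x l = P at *
  generalize ∑ l, A i l * m l = Q at *
  have hc : ψc i (x i + -(s * (x i - m i))) ≤ (1 - s) * ψc i (x i) + s * ψc i (m i) := by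
    have := (hconv i).2 (Set.mem_univ (x i)) (Set.mem_univ (m i)) (sub_nonneg.2 hs1) hs0 (by ring)
    simp only [smul_eq_mul] at this
    rwa [show x i + -(s * (x i - m i)) = (1 - s) * x i + s * m i by ring]
  have hl := neg_le_of_abs_le (hlip i (x i) (x i + -(s * (x i - m i))))
  have hl' : |x i - (x i + -(s * (x i - m i)))| = s * |x i - m i| := by
    rw [show x i - (x i + -(s * (x i - m i))) = s * (x i - m i) by ring, abs_mul, abs_of_nonneg hs0]
  rw [hl'] at hl
  have hy : C0 * |x i - m i| ≤ C0 ^ 2 / (2 * δ) + δ / 2 * (x i - m i) ^ 2 := by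
    rw [← sq_abs (x i - m i)]
    have : C0 ^ 2 / (2 * δ) + δ / 2 * |x i - m i| ^ 2 - C0 * |x i - m i| =
        (C0 - δ * |x i - m i|) ^ 2 / (2 * δ) := by
      field_simp
      ring
    have h0 : 0 ≤ (C0 - δ * |x i - m i|) ^ 2 / (2 * δ) := by positivity
    linarith
  have h1 := mul_le_mul_of_nonneg_left hrow hs0
  have h2 := mul_le_mul_of_nonneg_left hy hs0
  have h3 := mul_le_mul_of_nonneg_left (ha (x i)) hs0
  nlinarith

/-- Single-spin variances of a Gibbs measure whose interaction dominates its off-diagonal part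
by `δ` and whose single-site potentials are Lipschitz perturbations of convex functions. -/
lemma varOf_coordinate_le [DecidableEq κ] {ψ ψc ψb : κ → ℝ → ℝ} {A : κ → κ → ℝ}
    {b : κ → ℝ} {δ C0 : ℝ} (hδ : 0 < δ) (hψ : ∀ k, ψ k = ψc k + ψb k)
    (hcont : ∀ k, Continuous (ψ k))
    (hconv : ∀ k, ConvexOn ℝ Set.univ (ψc k)) (hdiff : ∀ k, Differentiable ℝ (ψc k))
    (hbdd : ∀ k t, |ψb k t| ≤ C0)
    (hlip : ∀ k t t', |ψb k t - ψb k t'| ≤ C0 * |t - t'|)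
    (hA : ∀ k l, A k l = A l k) (hpos : ∀ k, 0 ≤ A k k)
    (hdom : ∀ k, ∑ l, |A k l| + δ ≤ 2 * A k k) (j : κ) :
    varOf (volume.withDensity fun x =>
      ENNReal.ofReal (exp (-energy ψ A b x) / ∫ z, exp (-energy ψ A b z))) (fun x => x j) ≤
      8 / δ + 2 * C0 ^ 2 / δ ^ 2 := by
  set V := energy ψ A b
  have hV : Continuous V := continuous_energy hcont
  obtain ⟨K, hK⟩ := exists_energy_lower_bound (b := b) hδ hψ hconv hdiff hbdd hA hpos hdom
  have hw : Integrable fun x => exp (-V x) := by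
    simpa using integrable_exp_neg_mul_of_le (f := fun _ => 1) (c := 1) hδ hV hK
      continuous_const fun x => by
        have : 0 ≤ ∑ k, x k ^ 2 := Finset.sum_nonneg fun k _ => sq_nonneg _
        simpa using this
  set Z := ∫ z, exp (-V z) with hZdef
  have hZ : 0 < Z := integral_exp_pos hw
  set μ := (volume : Measure (κ → ℝ)).withDensity fun x => ENNReal.ofReal (exp (-V x) / Z)
  have hmeas : Measurable fun x => ENNReal.ofReal (exp (-V x) / Z) := by fun_prop
  have hdens : ∀ x, (ENNReal.ofReal (exp (-V x) / Z)).toReal = Z⁻¹ * exp (-V x) := fun x => by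
    rw [ENNReal.toReal_ofReal (by positivity), div_eq_inv_mul]
  have hμ : ∀ f : (κ → ℝ) → ℝ, ∫ x, f x ∂μ = Z⁻¹ * ∫ x, exp (-V x) * f x := fun f => by
    rw [integral_withDensity_eq_integral_toReal_smul hmeas (by simp), ← integral_const_mul]
    simp only [hdens, smul_eq_mul, mul_assoc]
  have hμint : ∀ f : (κ → ℝ) → ℝ, Integrable (fun x => exp (-V x) * f x) → Integrable f μ :=
    fun f hf => by
      rw [integrable_withDensity_iff_integrable_smul' hmeas (by simp)]
      simpa only [hdens, smul_eq_mul, mul_assoc] using hf.const_mul Z⁻¹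
  have hconst : ∀ c : ℝ, Integrable (fun _ => c) μ ∧ ∫ _, c ∂μ = c := fun c => by
    refine ⟨hμint _ (hw.mul_const c), ?_⟩
    rw [hμ, integral_mul_const, ← hZdef, inv_mul_cancel_left₀ hZ.ne']
  have hx : ∀ k, Integrable (fun x => x k) μ := fun k =>
    hμint _ (integrable_exp_neg_mul_of_le (c := 1) hδ hV hK (by fun_prop)
      fun x => by simpa using abs_coordinate_le x k)
  set m : κ → ℝ := fun k => ∫ x, x k ∂μ
  set σ : κ → ℝ := fun k => ∫ x, (x k - m k) ^ 2 ∂μ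
  have hu : ∀ k, Integrable (fun x => x k - m k) μ := fun k => (hx k).sub (hconst _).1
  have hu0 : ∀ k, ∫ x, (x k - m k) ∂μ = 0 := fun k => by
    rw [integral_sub (hx k) (hconst _).1, (hconst _).2, sub_self]
  have hu2 : ∀ k, Integrable (fun x => (x k - m k) ^ 2) μ := fun k =>
    hμint _ (integrable_exp_neg_mul_of_le hδ hV hK (by fun_prop)
      fun x => abs_sq_coordinate_sub_le x k (m k))
  obtain ⟨i, -, hi⟩ := Finset.exists_max_image Finset.univ σ ⟨j, Finset.mem_univ j⟩
  change σ j ≤ _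
  refine (hi j (Finset.mem_univ j)).trans ?_
  have hσ0 : 0 ≤ σ i := integral_nonneg fun x => sq_nonneg _
  obtain ⟨a, ha⟩ := exists_le_energy_sub_contract (b := b) hδ hψ hconv hdiff hlip hA hpos i m
  have hAδ : δ ≤ A i i := by
    have := Finset.single_le_sum (fun l _ => abs_nonneg (A i l)) (Finset.mem_univ i)
    linarith [hdom i, le_abs_self (A i i)]
  have hAi : 0 < A i i := hδ.trans_le hAδ
  set s := δ / (2 * A i i)
  have hs0 : 0 < s := by positivity
  have hs1 : s ≤ 1 / 2 := by
    rw [div_le_div_iff₀ (by positivity) (by positivity)]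
    linarith
  have hsA : s * A i i / 2 = δ / 4 := by
    simp only [s]
    field_simp
    ring
  obtain ⟨hTint, hTeq⟩ := contract_coordinate hw i (m i) s (by linarith)
  have hexp : ∀ x y, exp (-V x) * exp (V x - V y) = exp (-V y) := fun x y => by
    rw [← exp_add]
    ring_nf
  set L : (κ → ℝ) → ℝ := fun x => a * (x i - m i) - C0 ^ 2 / (2 * δ)
        + (2 * A i i - δ / 2 - s * A i i / 2) * (x i - m i) ^ 2
        - (∑ l, |A i l| * ((x i - m i) ^ 2 + (x l - m l) ^ 2)) / 2
  have hR : ∀ l, Integrable (fun x => |A i l| * ((x i - m i) ^ 2 + (x l - m l) ^ 2)) μ :=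
    fun l => ((hu2 i).add (hu2 l)).const_mul _
  have hRi : Integrable (fun x => (∑ l, |A i l| * ((x i - m i) ^ 2 + (x l - m l) ^ 2)) / 2) μ :=
    (integrable_finsetSum _ fun l _ => hR l).div_const 2
  have hL1 : Integrable (fun x => a * (x i - m i) - C0 ^ 2 / (2 * δ)) μ :=
    ((hu i).const_mul a).sub (hconst _).1
  have hL2 : Integrable (fun x => a * (x i - m i) - C0 ^ 2 / (2 * δ)
      + (2 * A i i - δ / 2 - s * A i i / 2) * (x i - m i) ^ 2) μ :=
    hL1.add ((hu2 i).const_mul _)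
  have hLi : Integrable L μ := hL2.sub hRi
  have hLeq : ∫ x, L x ∂μ = -(C0 ^ 2 / (2 * δ)) + (2 * A i i - δ / 2 - s * A i i / 2) * σ i
      - (∑ l, |A i l| * (σ i + σ l)) / 2 := by
    rw [integral_sub hL2 hRi, integral_add hL1 ((hu2 i).const_mul _),
      integral_sub ((hu i).const_mul a) (hconst _).1, integral_const_mul, integral_const_mul,
      (hconst _).2, hu0, integral_div, integral_finsetSum _ fun l _ => hR l]
    simp only [integral_const_mul, integral_add (hu2 _) (hu2 _)]
    ring
  have hmain : 1 + s * ∫ x, L x ∂μ ≤ (1 - s)⁻¹ := by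
    calc 1 + s * ∫ x, L x ∂μ = ∫ x, (1 + s * L x) ∂μ := by
          rw [integral_add (hconst 1).1 (hLi.const_mul s), (hconst 1).2, integral_const_mul]
      _ ≤ ∫ x, exp (V x - V (x + Pi.single i (-(s * (x i - m i))))) ∂μ := by
          refine integral_mono ((hconst 1).1.add (hLi.const_mul s))
            (hμint _ (by simpa only [hexp] using hTint)) fun x => ?_
          have h1 : s * L x ≤ V x - V _ := ha s hs0.le (by linarith) x
          have h2 := add_one_le_exp (V x - V (x + Pi.single i (-(s * (x i - m i)))))
          change 1 + s * L x ≤ _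
          linarith
      _ = (1 - s)⁻¹ := by
          rw [hμ]
          simp only [hexp]
          rw [hTeq, mul_left_comm, inv_mul_cancel₀ hZ.ne', mul_one]
  have hL : ∫ x, L x ∂μ ≤ 2 := by
    have h1 : (1 - s)⁻¹ ≤ 1 + s * 2 := by
      rw [inv_le_iff_one_le_mul₀ (by linarith)]
      nlinarith
    nlinarith
  have hsum : (∑ l, |A i l| * (σ i + σ l)) / 2 ≤ (∑ l, |A i l|) * σ i := by
    rw [Finset.sum_mul, Finset.sum_div]
    refine Finset.sum_le_sum fun l _ => ?_
    nlinarith [hi l (Finset.mem_univ l), abs_nonneg (A i l)]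
  have hfin : δ / 4 * σ i ≤ 2 + C0 ^ 2 / (2 * δ) := by
    rw [hLeq, hsA] at hL
    nlinarith [hdom i]
  have : 8 / δ + 2 * C0 ^ 2 / δ ^ 2 = 4 / δ * (2 + C0 ^ 2 / (2 * δ)) := by
    field_simp
    ring
  rw [this]
  calc σ i = 4 / δ * (δ / 4 * σ i) := by field_simp
    _ ≤ _ := by gcongr

end FiniteVolume

lemma ham_patch_eq_energy (ψ : ι → ℝ → ℝ) (M : ι → ι → ℝ) (Λ : Finset ι) (ω : ι → ℝ)
    (x : ↥Λ → ℝ) :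
    ham ψ M Λ (patch Λ x ω) =
      energy (fun k : ↥Λ => ψ k) (fun k l : ↥Λ => M k l)
        (fun k : ↥Λ => ∑' j : {j : ι // j ∉ Λ}, M k j * ω j) x := by
  have hin : ∀ k : ↥Λ, patch Λ x ω k = x k := fun k => by simp [patch]
  have hout : ∀ j : {j : ι // j ∉ Λ}, patch Λ x ω j = ω j := fun j => by simp [patch, j.2]
  unfold ham energy
  simp only [← Finset.sum_coe_sort Λ, hin, hout]

lemma sum_abs_row_add_le {α : Type*} {M : α → α → ℝ} {δ : ℝ} (hδ : 0 < δ) (k : α)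
    (hsum : Summable fun j => |M k j|)
    (hdom : (∑' j : {j : α // j ≠ k}, |M k j|) + δ ≤ M k k) (Λ : Finset α) :
    0 ≤ M k k ∧ ∑ l : ↥Λ, |M k l| + δ ≤ 2 * M k k := by
  have h0 : 0 ≤ ∑' j : {j : α // j ≠ k}, |M k j| := tsum_nonneg fun _ => abs_nonneg _
  have hpos : 0 ≤ M k k := by linarith
  have h1 : ∑' j, |M k j| = |M k k| + ∑' j : {j : α // j ≠ k}, |M k j| := by
    have := hsum.tsum_subtype_add_tsum_subtype_compl {k}
    rw [tsum_singleton k (fun j => |M k j|)] at this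
    exact this.symm
  have h2 := hsum.sum_le_tsum Λ fun _ _ => abs_nonneg _
  rw [Finset.sum_coe_sort Λ (fun l => |M k l|)]
  rw [abs_of_nonneg hpos] at h1
  exact ⟨hpos, by linarith⟩

/-- the single-spin variances of the finite-volume Gibbs measures are
bounded uniformly in the volume, the boundary condition and the site, by a constant
depending only on `δ`, `C0` and `sup_i Σ_j |M_{ij}|`. -/
theorem uniform_variance_bound
    (δ C0 Msum : ℝ) (hδ : 0 < δ) (hC0 : 0 ≤ C0) :
    ∃ C : ℝ, 0 < C ∧
      ∀ (d : ℕ), 1 ≤ d →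
        ∀ (ψ ψc ψb : (Fin d → ℤ) → ℝ → ℝ) (M : (Fin d → ℤ) → (Fin d → ℤ) → ℝ),
          (∀ i, ψ i = ψc i + ψb i) →
          (∀ i, ContDiff ℝ (⊤ : ℕ∞) (ψ i)) → (∀ i, ContDiff ℝ (⊤ : ℕ∞) (ψc i)) →
          (∀ i, ContDiff ℝ (⊤ : ℕ∞) (ψb i)) →
          (∀ i z, 0 ≤ deriv (deriv (ψc i)) z) →
          (∀ i z, |ψb i z| + |deriv (ψb i) z| ≤ C0) →
          (∀ i j, M i j = M j i) →
          (∀ i, Summable fun j => |M i j|) →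
          (∀ i, (∑' j, |M i j|) ≤ Msum) →
          (∀ i, (∑' j : {j : Fin d → ℤ // j ≠ i}, |M i j.1|) + δ ≤ M i i) →
          ∀ (Λ : Finset (Fin d → ℤ)) (ω : (Fin d → ℤ) → ℝ), tempered M Λ ω →
            ∀ (i) (hi : i ∈ Λ),
              varOf (gibbs ψ M Λ ω) (fun x => x ⟨i, hi⟩) ≤ C := by
  refine ⟨8 / δ + 2 * C0 ^ 2 / δ ^ 2, by positivity, ?_⟩
  intro d _ ψ ψc ψb M hψ hψs hψc hψb hconv hbdd hM hsum _ hdom Λ ω _ i hi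
  have hrow := fun k => sum_abs_row_add_le hδ k (hsum k) (hdom k) Λ
  have hconv' : ∀ k, ConvexOn ℝ Set.univ (ψc k) := fun k =>
    convexOn_univ_of_deriv2_nonneg ((hψc k).differentiable (by simp))
      (((contDiff_infty_iff_deriv.1 (hψc k)).2).differentiable (by simp)) (hconv k)
  have hlip : ∀ k t t', |ψb k t - ψb k t'| ≤ C0 * |t - t'| := fun k t t' =>
    Convex.norm_image_sub_le_of_norm_deriv_le (s := Set.univ)
      (fun z _ => (hψb k).differentiable (by simp) z)
      (fun z _ => by
        rw [norm_eq_abs]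
        linarith [hbdd k z, abs_nonneg (ψb k z)])
      convex_univ (Set.mem_univ t') (Set.mem_univ t)
  unfold gibbs
  simp only [ham_patch_eq_energy]
  exact varOf_coordinate_le (ψc := fun k : ↥Λ => ψc k) (ψb := fun k : ↥Λ => ψb k)
    hδ (fun k => hψ k) (fun k => (hψs k).continuous) (fun k => hconv' k)
    (fun k => (hψc k).differentiable (by simp))
    (fun k t => by linarith [hbdd k t, abs_nonneg (deriv (ψb k) t)])
    (fun k => hlip k) (fun k l => hM k l) (fun k => (hrow k).1) (fun k => (hrow k).2) ⟨i, hi⟩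

end GibbsLSI
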